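/- For g ∈ GU(V,H) set α := ν(g)²·(det g)^{-1} ∈ E^×. Then: (i) α·ρ(α) = 1; (ii) for every β ∈ E^× with α = β·ρ(β)^{-1}, the map f_β : Ṽ → Ṽ, f_β(x) := (⋀²g)(x)·β, is a right-B-linear automorphism of Ṽ and lies in GU_B(Ṽ) with similitude factor N(β)·ν(g)² ∈ F^×; (iii) the class of f_β in GU_B(Ṽ)/F^× is independent of the choice of β, the resulting map GU(V,H) → GU_B(Ṽ)/F^× is a group homomorphism, and its kernel equals the subgroup of E^×-scalar multiplications { x ↦ x·λ : λ ∈ E^× }. -/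

import Mathlib

/-- The canonical generator `v₁ ∧ ⋯ ∧ vₙ` of the `n`-th exterior power, as an element of the
submodule `⋀[E]^n V` of the exterior algebra. -/
noncomputable def wedgeι (E : Type*) [CommRing E] {V : Type*} [AddCommGroup V] [Module E V]
    (n : ℕ) (v : Fin n → V) : ⋀[E]^n V :=
  ⟨ExteriorAlgebra.ιMulti E n v, ExteriorAlgebra.ιMulti_range E n (Set.mem_range_self v)⟩

/-- The wedge (exterior) product `⋀²V × ⋀²V → ⋀⁴V`. -/
noncomputable def wedgeMul (E : Type*) [CommRing E] {V : Type*} [AddCommGroup V] [Module E V]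
    (x y : ⋀[E]^2 V) : ⋀[E]^4 V :=
  ⟨(x : ExteriorAlgebra E V) * (y : ExteriorAlgebra E V), by
    have h := Submodule.mul_mem_mul x.2 y.2
    have e : (⋀[E]^2 V) * (⋀[E]^2 V) = ⋀[E]^4 V := by
      show LinearMap.range (ExteriorAlgebra.ι E (M := V)) ^ 2 *
          LinearMap.range (ExteriorAlgebra.ι E (M := V)) ^ 2
        = LinearMap.range (ExteriorAlgebra.ι E (M := V)) ^ 4
      rw [← pow_add]
    exact e ▸ h⟩

/-- `h` is a form on `⋀^r V`, additive in each variable, `ρ`-sesquilinear, conjugate-symmetric,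
whose value on decomposable wedges is the determinant `det (H (v i) (w j))`. -/
def IsDetForm {E : Type*} [Field E] (ρ : E →+* E)
    {V : Type*} [AddCommGroup V] [Module E V] (H : V → V → E) (r : ℕ)
    (h : (⋀[E]^r V) → (⋀[E]^r V) → E) : Prop :=
  (∀ x y z, h (x + y) z = h x z + h y z) ∧
  (∀ x y z, h x (y + z) = h x y + h x z) ∧
  (∀ (a b : E) (x y : ⋀[E]^r V), h (a • x) (b • y) = ρ a * h x y * b) ∧
  (∀ x y, h x y = ρ (h y x)) ∧
  (∀ v w : Fin r → V,
    h (wedgeι E r v) (wedgeι E r w) = (Matrix.of fun i j => H (v i) (w j)).det)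


/-- The quaternion algebra `B = E ⊕ E𝐣` (elements written `a + b·𝐣`) attached to the quadratic
extension `E` with conjugation `ρ` and to `J = 𝐣² ∈ E`; multiplication is determined by
`𝐣² = J` and `α·𝐣 = 𝐣·ρ(α)`. -/
def Qa {E : Type*} [Field E] (ρ : E →+* E) (J : E) : Type _ := E × E

namespace Qa

variable {E : Type*} [Field E] {ρ : E →+* E} {J : E}

instance : AddCommGroup (Qa ρ J) := inferInstanceAs (AddCommGroup (E × E))
instance : Module E (Qa ρ J) := inferInstanceAs (Module E (E × E))

/-- The element `a + b·𝐣` of `B`. -/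
def mk' (ρ : E →+* E) (J : E) (a b : E) : Qa ρ J := (a, b)

/-- The `E`-component of `a + b·𝐣`. -/
def re (x : Qa ρ J) : E := Prod.fst x

/-- The `𝐣`-coefficient of `a + b·𝐣`. -/
def im (x : Qa ρ J) : E := Prod.snd x

instance : One (Qa ρ J) := ⟨mk' ρ J 1 0⟩

/-- Multiplication: `(a + b𝐣)(c + d𝐣) = (ac + J·b·ρ(d)) + (ad + b·ρ(c))·𝐣`. -/
instance : Mul (Qa ρ J) :=
  ⟨fun x y => mk' ρ J (re x * re y + J * (im x * ρ (im y))) (re x * im y + im x * ρ (re y))⟩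

/-- The main involution `(a + b𝐣)^* = ρ(a) - b𝐣` of `B`. -/
def conj (x : Qa ρ J) : Qa ρ J := mk' ρ J (ρ (re x)) (-im x)

/-- The embedding `E → B`. -/
def scalar (ρ : E →+* E) (J : E) (c : E) : Qa ρ J := mk' ρ J c 0

/-- The element `𝐣 ∈ B`. -/
def jay (ρ : E →+* E) (J : E) : Qa ρ J := mk' ρ J 0 1

end Qa


/-- The right action of `B = E ⊕ E𝐣` on `Ṽ = ⋀²V`, where `E` acts by scalars and `x·𝐣 = L(x)`
(so `x·(a + b𝐣) = a•x + ρ(b)•L(x)`). -/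
def actB {E : Type*} [Field E] (ρ : E →+* E) (J : E) {M : Type*} [AddCommGroup M] [Module E M]
    (L : M → M) (x : M) (q : Qa ρ J) : M :=
  Qa.re q • x + ρ (Qa.im q) • L x

/-- The `B`-valued form `⟨x,y⟩ = (x,y) - J⁻¹·𝐣·(L(x),y)` on `Ṽ`, where `(x,y) = 𝐢·h₂(x,y)`. -/
noncomputable def qform {E : Type*} [Field E] (ρ : E →+* E) (J : E) (i0 : E)
    {M : Type*} [AddCommGroup M] [Module E M] (h₂ : M → M → E) (L : M → M)
    (x y : M) : Qa ρ J :=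
  Qa.scalar ρ J (i0 * h₂ x y) -
    Qa.scalar ρ J J⁻¹ * Qa.jay ρ J * Qa.scalar ρ J (i0 * h₂ (L x) y)

section Helpers

open Module

variable {E : Type*} [Field E] {V : Type*} [AddCommGroup V] [Module E V]

theorem wedgeι_eq (n : ℕ) (v : Fin n → V) : wedgeι E n v = exteriorPower.ιMulti E n v := rfl

theorem wedge_induction {n : ℕ} {p : (⋀[E]^n V) → Prop} (x : ⋀[E]^n V)
    (hι : ∀ v, p (wedgeι E n v)) (h0 : p 0) (hadd : ∀ x y, p x → p y → p (x + y))
    (hsmul : ∀ (a : E) x, p x → p (a • x)) : p x := by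
  have hx : x ∈ Submodule.span E (Set.range (exteriorPower.ιMulti E n (M := V))) := by
    rw [exteriorPower.ιMulti_span]; trivial
  induction hx using Submodule.span_induction with
  | mem x h => obtain ⟨v, rfl⟩ := h; exact hι v
  | zero => exact h0
  | add x y _ _ hx hy => exact hadd x y hx hy
  | smul a x _ hx => exact hsmul a x hx

theorem wedgeMul_add_left (x y z : ⋀[E]^2 V) :
    wedgeMul E (x + y) z = wedgeMul E x z + wedgeMul E y z := by
  apply Subtype.ext; simp [wedgeMul, add_mul]

theorem wedgeMul_sub_left (x y z : ⋀[E]^2 V) :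
    wedgeMul E (x - y) z = wedgeMul E x z - wedgeMul E y z := by
  apply Subtype.ext; simp [wedgeMul, sub_mul]

theorem wedgeMul_add_right (x y z : ⋀[E]^2 V) :
    wedgeMul E x (y + z) = wedgeMul E x y + wedgeMul E x z := by
  apply Subtype.ext; simp [wedgeMul, mul_add]

theorem wedgeMul_smul_left (a : E) (x z : ⋀[E]^2 V) :
    wedgeMul E (a • x) z = a • wedgeMul E x z := by
  apply Subtype.ext; simp [wedgeMul]

theorem wedgeMul_smul_right (a : E) (x z : ⋀[E]^2 V) :
    wedgeMul E x (a • z) = a • wedgeMul E x z := by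
  apply Subtype.ext; simp [wedgeMul]

theorem wedgeMul_wedgeι (v w : Fin 2 → V) :
    wedgeMul E (wedgeι E 2 v) (wedgeι E 2 w) = wedgeι E 4 ![v 0, v 1, w 0, w 1] := by
  apply Subtype.ext
  simp [wedgeMul, wedgeι, ExteriorAlgebra.ιMulti_apply, mul_assoc]
  rfl

/-- The alternating 4-form attached to `d`. -/
noncomputable def volForm (d : (⋀[E]^4 V) ≃ₗ[E] E) : V [⋀^Fin 4]→ₗ[E] E :=
  (d : (⋀[E]^4 V) →ₗ[E] E).compAlternatingMap (exteriorPower.ιMulti E 4)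

theorem volForm_apply (d : (⋀[E]^4 V) ≃ₗ[E] E) (v : Fin 4 → V) :
    volForm d v = d (wedgeι E 4 v) := rfl

theorem volForm_ne_zero (d : (⋀[E]^4 V) ≃ₗ[E] E) : volForm d ≠ 0 := by
  intro h
  have h1 : (d : (⋀[E]^4 V) →ₗ[E] E) = 0 := by
    apply exteriorPower.linearMap_ext
    change volForm d = _
    rw [h]; rfl
  have h2 : d (d.symm 1) = 0 := LinearMap.congr_fun h1 (d.symm 1)
  simp at h2

theorem volForm_basis (d : (⋀[E]^4 V) ≃ₗ[E] E) (e : Basis (Fin 4) E V) : volForm d e ≠ 0 :=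
  ((volForm d).map_basis_ne_zero_iff e).2 (volForm_ne_zero d)

theorem volForm_comp (hV4 : finrank E V = 4) [FiniteDimensional E V]
    (d : (⋀[E]^4 V) ≃ₗ[E] E) (g : V →ₗ[E] V) (v : Fin 4 → V) :
    volForm d (g ∘ v) = LinearMap.det g * volForm d v := by
  let e : Basis (Fin 4) E V := finBasisOfFinrankEq E V hV4
  rw [(volForm d).eq_smul_basis_det e]
  simp only [AlternatingMap.smul_apply, Basis.det_comp, smul_eq_mul]
  ring

theorem d_wedgeMul_map (hV4 : finrank E V = 4) [FiniteDimensional E V]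
    (d : (⋀[E]^4 V) ≃ₗ[E] E) (g : V →ₗ[E] V) (Λ : (⋀[E]^2 V) →ₗ[E] (⋀[E]^2 V))
    (hΛ : ∀ v : Fin 2 → V, Λ (wedgeι E 2 v) = wedgeι E 2 (⇑g ∘ v)) (x y : ⋀[E]^2 V) :
    d (wedgeMul E (Λ x) (Λ y)) = LinearMap.det g * d (wedgeMul E x y) := by
  have zl : ∀ z : ⋀[E]^2 V, wedgeMul E 0 z = 0 := fun z => by
    simpa using wedgeMul_smul_left (0 : E) 0 z
  have zr : ∀ z : ⋀[E]^2 V, wedgeMul E z 0 = 0 := fun z => by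
    simpa using wedgeMul_smul_right (0 : E) z 0
  induction x using wedge_induction with
  | h0 => simp [zl]
  | hadd x x' h h' => simp [wedgeMul_add_left, h, h', mul_add]
  | hsmul a x h => simp [wedgeMul_smul_left, h]; ring
  | hι v =>
    induction y using wedge_induction with
    | h0 => simp [zr]
    | hadd x x' h h' => simp [wedgeMul_add_right, h, h', mul_add]
    | hsmul a x h => simp [wedgeMul_smul_right, h]; ring
    | hι w =>
      rw [hΛ, hΛ, wedgeMul_wedgeι, wedgeMul_wedgeι, ← volForm_apply, ← volForm_apply,
        ← volForm_comp hV4]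
      congr 1
      ext i; fin_cases i <;> rfl

/-- The functional `z ↦ d (z ∧ u ∧ v)`. -/
noncomputable def pairL (d : (⋀[E]^4 V) ≃ₗ[E] E) (y : ⋀[E]^2 V) : (⋀[E]^2 V) →ₗ[E] E where
  toFun z := d (wedgeMul E z y)
  map_add' a b := by simp [wedgeMul_add_left]
  map_smul' a b := by simp [wedgeMul_smul_left]

theorem wedge_nondeg (hV4 : finrank E V = 4) [FiniteDimensional E V]
    (d : (⋀[E]^4 V) ≃ₗ[E] E) (z : ⋀[E]^2 V) (hz : ∀ y, d (wedgeMul E z y) = 0) : z = 0 := by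
  let e : Basis (Fin 4) E V := finBasisOfFinrankEq E V hV4
  let w : Fin 4 → Fin 4 → ⋀[E]^2 V := fun i j => wedgeι E 2 ![e i, e j]
  have key : volForm d e • (LinearMap.id : (⋀[E]^2 V) →ₗ[E] (⋀[E]^2 V)) =
      (pairL d (w 2 3)).smulRight (w 0 1) - (pairL d (w 1 3)).smulRight (w 0 2)
      + (pairL d (w 1 2)).smulRight (w 0 3) + (pairL d (w 0 3)).smulRight (w 1 2)
      - (pairL d (w 0 2)).smulRight (w 1 3) + (pairL d (w 0 1)).smulRight (w 2 3) := by
    apply exteriorPower.linearMap_ext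
    apply Basis.ext_alternating e
    intro v hv
    have hw : ∀ i j : Fin 4, w j i = - w i j := by
      intro i j
      have := (exteriorPower.ιMulti E 2 (M := V)).map_swap ![e i, e j]
        (i := 0) (j := 1) (by decide)
      rw [← wedgeι_eq, ← wedgeι_eq] at this
      rw [← this]
      change wedgeι E 2 _ = _
      congr 1
      ext k; fin_cases k <;> rfl
    have hP : ∀ i j k l : Fin 4, pairL d (w k l) (w i j) = volForm d ![e i, e j, e k, e l] := by
      intro i j k l
      change d (wedgeMul E (wedgeι E 2 _) (wedgeι E 2 _)) = _
      rw [wedgeMul_wedgeι, ← volForm_apply]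
      rfl
    have hP0 : ∀ i j k l : Fin 4, (i = k ∨ i = l ∨ j = k ∨ j = l) →
        pairL d (w k l) (w i j) = 0 := by
      intro i j k l h
      rw [hP]
      rcases h with h | h | h | h
      · exact (volForm d).map_eq_zero_of_eq _ (i := 0) (j := 2) (by simp [h]) (by decide)
      · exact (volForm d).map_eq_zero_of_eq _ (i := 0) (j := 3) (by simp [h]) (by decide)
      · exact (volForm d).map_eq_zero_of_eq _ (i := 1) (j := 2) (by simp [h]) (by decide)
      · exact (volForm d).map_eq_zero_of_eq _ (i := 1) (j := 3) (by simp [h]) (by decide)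
    have hPσ : ∀ (i j k l : Fin 4) (σ : Equiv.Perm (Fin 4)), ![i, j, k, l] = σ →
        pairL d (w k l) (w i j) = Equiv.Perm.sign σ • volForm d e := by
      intro i j k l σ h
      rw [hP, ← AlternatingMap.map_perm]
      congr 1
      ext m
      rw [Function.comp_apply, ← h]
      fin_cases m <;> rfl
    have h01 : pairL d (w 2 3) (w 0 1) = volForm d e := by
      rw [hPσ 0 1 2 3 1 (by decide)]; simp
    have h02 : pairL d (w 1 3) (w 0 2) = - volForm d e := by
      rw [hPσ 0 2 1 3 (Equiv.swap 1 2) (by decide)]; simp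
    have h03 : pairL d (w 1 2) (w 0 3) = volForm d e := by
      rw [hPσ 0 3 1 2 (Equiv.swap 1 2 * Equiv.swap 1 3) (by decide)]; simp
    have h12 : pairL d (w 0 3) (w 1 2) = volForm d e := by
      rw [hPσ 1 2 0 3 (Equiv.swap 0 1 * Equiv.swap 1 2) (by decide)]; simp
    have h13 : pairL d (w 0 2) (w 1 3) = - volForm d e := by
      rw [hPσ 1 3 0 2 (Equiv.swap 0 1 * Equiv.swap 1 3 * Equiv.swap 2 3) (by decide)]; simp
    have h23 : pairL d (w 0 1) (w 2 3) = volForm d e := by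
      rw [hPσ 2 3 0 1 (Equiv.swap 0 2 * Equiv.swap 1 3) (by decide)]; simp
    have hv' : exteriorPower.ιMulti E 2 (fun i => e (v i)) = w (v 0) (v 1) := by
      rw [← wedgeι_eq]
      change _ = wedgeι E 2 _
      congr 1
      ext k; fin_cases k <;> rfl
    simp only [LinearMap.compAlternatingMap_apply, hv']
    have hne : v 0 ≠ v 1 := fun h => absurd (hv h) (by decide)
    generalize v 0 = a at hne ⊢
    generalize v 1 = b at hne ⊢
    clear_value w
    clear hv hv' v hz hPσ hP
    wlog hab : a < b generalizing a b
    · have h := this b a hne.symm (lt_of_le_of_ne (not_lt.1 hab) hne.symm)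
      rw [hw b a, map_neg, map_neg, h]
    have hc : (a = 0 ∧ b = 1) ∨ (a = 0 ∧ b = 2) ∨ (a = 0 ∧ b = 3) ∨ (a = 1 ∧ b = 2) ∨
        (a = 1 ∧ b = 3) ∨ (a = 2 ∧ b = 3) := by
      clear * - hab
      revert a b; decide
    simp only [LinearMap.smul_apply, LinearMap.id_apply,
      LinearMap.add_apply, LinearMap.sub_apply, LinearMap.smulRight_apply]
    rcases hc with ⟨rfl, rfl⟩ | ⟨rfl, rfl⟩ | ⟨rfl, rfl⟩ | ⟨rfl, rfl⟩ | ⟨rfl, rfl⟩ | ⟨rfl, rfl⟩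
    · rw [h01, hP0 0 1 1 3 (by decide), hP0 0 1 1 2 (by decide), hP0 0 1 0 3 (by decide),
        hP0 0 1 0 2 (by decide), hP0 0 1 0 1 (by decide)]; module
    · rw [h02, hP0 0 2 2 3 (by decide), hP0 0 2 1 2 (by decide), hP0 0 2 0 3 (by decide),
        hP0 0 2 0 2 (by decide), hP0 0 2 0 1 (by decide)]; module
    · rw [h03, hP0 0 3 2 3 (by decide), hP0 0 3 1 3 (by decide), hP0 0 3 0 3 (by decide),
        hP0 0 3 0 2 (by decide), hP0 0 3 0 1 (by decide)]; module
    · rw [h12, hP0 1 2 2 3 (by decide), hP0 1 2 1 3 (by decide), hP0 1 2 1 2 (by decide),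
        hP0 1 2 0 2 (by decide), hP0 1 2 0 1 (by decide)]; module
    · rw [h13, hP0 1 3 2 3 (by decide), hP0 1 3 1 3 (by decide), hP0 1 3 1 2 (by decide),
        hP0 1 3 0 3 (by decide), hP0 1 3 0 1 (by decide)]; module
    · rw [h23, hP0 2 3 2 3 (by decide), hP0 2 3 1 3 (by decide), hP0 2 3 1 2 (by decide),
        hP0 2 3 0 3 (by decide), hP0 2 3 0 2 (by decide)]; module
  have := LinearMap.congr_fun key z
  have hz' : ∀ y, pairL d y z = 0 := hz
  simp only [LinearMap.smul_apply, LinearMap.id_apply,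
      LinearMap.add_apply, LinearMap.sub_apply, LinearMap.smulRight_apply, hz'] at this
  simpa [volForm_basis d e] using this

theorem h₂_map {ρ : E →+* E} {H : V → V → E} {h₂ : (⋀[E]^2 V) → (⋀[E]^2 V) → E}
    (hh₂ : IsDetForm ρ H 2 h₂) (g : V → V) (n : E) (hg : ∀ x y, H (g x) (g y) = n * H x y)
    (Λ : (⋀[E]^2 V) →ₗ[E] (⋀[E]^2 V))
    (hΛ : ∀ v : Fin 2 → V, Λ (wedgeι E 2 v) = wedgeι E 2 (g ∘ v)) (x y : ⋀[E]^2 V) :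
    h₂ (Λ x) (Λ y) = n ^ 2 * h₂ x y := by
  obtain ⟨hl, hr, hs, -, hdet⟩ := hh₂
  have sl : ∀ (a : E) x y, h₂ (a • x) y = ρ a * h₂ x y := fun a x y => by
    simpa using hs a 1 x y
  have sr : ∀ (a : E) x y, h₂ x (a • y) = h₂ x y * a := fun a x y => by
    simpa using hs 1 a x y
  have zl : ∀ y, h₂ 0 y = 0 := fun y => by simpa using sl 0 0 y
  have zr : ∀ y, h₂ y 0 = 0 := fun y => by simpa using sr 0 y 0
  induction x using wedge_induction with
  | h0 => simp [zl]
  | hadd x x' h h' => simp [hl, h, h', mul_add]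
  | hsmul a x h => simp [sl, h]; ring
  | hι v =>
    induction y using wedge_induction with
    | h0 => simp [zr]
    | hadd x x' h h' => simp [hr, h, h', mul_add]
    | hsmul a x h => simp [sr, h]; ring
    | hι w =>
      rw [hΛ, hΛ, hdet, hdet]
      simp [Matrix.det_fin_two, hg]
      ring

theorem Λ_bijective (g : V ≃ₗ[E] V) (Λ : (⋀[E]^2 V) →ₗ[E] (⋀[E]^2 V))
    (hΛ : ∀ v : Fin 2 → V, Λ (wedgeι E 2 v) = wedgeι E 2 (⇑g ∘ v)) : Function.Bijective Λ := by
  have h : Λ = exteriorPower.map 2 (g : V →ₗ[E] V) := by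
    apply exteriorPower.linearMap_ext
    ext v
    simpa [← wedgeι_eq, Function.comp_def] using congrArg Subtype.val (hΛ v)
  rw [h]
  exact ⟨exteriorPower.map_injective (g.symm : V →ₗ[E] V) (by ext; simp),
    exteriorPower.map_surjective g.surjective⟩

/-- If `⋀²g` is a nonzero scalar then `g` is a scalar. -/
theorem scalar_of_wedge_scalar (hV4 : finrank E V = 4) [FiniteDimensional E V]
    (d : (⋀[E]^4 V) ≃ₗ[E] E) (g : V →ₗ[E] V) (c : E) (hc : c ≠ 0)
    (h : ∀ v : Fin 2 → V, wedgeι E 2 (⇑g ∘ v) = c • wedgeι E 2 v) :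
    ∃ a : E, ∀ u, g u = a • u := by
  obtain ⟨a, ha⟩ := LinearMap.exists_eq_smul_id_of_forall_notLinearIndependent (f := g) (by
    intro u hu
    obtain ⟨v, hv⟩ := exists_linearIndependent_cons_of_lt_finrank hu (by omega)
    obtain ⟨w, hw⟩ := exists_linearIndependent_cons_of_lt_finrank hv (by omega)
    let e := basisOfLinearIndependentOfCardEqFinrank hw (by simp [hV4])
    have he : volForm d ![w, v, u, g u] ≠ 0 := by
      have := volForm_basis d e
      rw [coe_basisOfLinearIndependentOfCardEqFinrank] at this
      exact this
    have hs := (volForm d).map_swap ![w, v, u, g u] (i := 1) (j := 3) (by decide)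
    have hs' : ![w, v, u, g u] ∘ Equiv.swap (1 : Fin 4) 3 = ![w, g u, u, v] := by
      ext k; fin_cases k <;> rfl
    rw [hs'] at hs
    apply he
    rw [← neg_eq_zero, ← hs]
    have h1 : c * volForm d ![w, g u, u, v] = volForm d ![w, g u, g u, g v] := by
      have e1 : volForm d ![w, g u, u, v] =
          d (wedgeMul E (wedgeι E 2 ![w, g u]) (wedgeι E 2 ![u, v])) := by
        rw [wedgeMul_wedgeι, volForm_apply]; rfl
      have e2 : volForm d ![w, g u, g u, g v] =
          d (wedgeMul E (wedgeι E 2 ![w, g u]) (wedgeι E 2 (g ∘ ![u, v]))) := by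
        rw [wedgeMul_wedgeι, volForm_apply]; rfl
      rw [e1, e2, h, wedgeMul_smul_right]; simp
    have h2 : volForm d ![w, g u, g u, g v] = 0 :=
      (volForm d).map_eq_zero_of_eq _ (i := 1) (j := 2) (by simp) (by decide)
    rw [h2] at h1
    exact (mul_eq_zero.1 h1).resolve_left hc)
  exact ⟨a, fun u => by rw [ha]; simp⟩

/-- `β/β'` is in `F` when `β/ρβ = β'/ρβ'`. -/
theorem ratio_fixed {F : Type*} [Field F] [Algebra F E] (ρ : E →+* E)
    (hfix : ∀ a : E, ρ a = a → ∃ c : F, algebraMap F E c = a)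
    (β β' : E) (hβ : β ≠ 0) (hβ' : β' ≠ 0) (h : β * (ρ β)⁻¹ = β' * (ρ β')⁻¹) :
    ∃ t : F, t ≠ 0 ∧ β' = algebraMap F E t * β := by
  have r1 : ρ β ≠ 0 := (map_ne_zero ρ).2 hβ
  have r2 : ρ β' ≠ 0 := (map_ne_zero ρ).2 hβ'
  obtain ⟨t, ht⟩ := hfix (β' / β) (by
    rw [map_div₀]
    field_simp at h ⊢
    linear_combination h)
  have : β' = algebraMap F E t * β := by rw [ht]; field_simp
  refine ⟨t, ?_, this⟩
  rintro rfl
  simp at this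
  exact hβ' this

end Helpers


/-- For `g ∈ GU(V,H)` with similitude factor `ν`, put `α = ν²·(det g)⁻¹`.
Then (i) `α·ρ(α) = 1`; (ii) for any `β ∈ E^×` with `α = β·ρ(β)⁻¹`, the map
`f_β : x ↦ β • ⋀²g(x)` is a right-`B`-linear automorphism of `Ṽ` lying in `GU_B(Ṽ)` with
similitude factor `N(β)·ν² ∈ F^×`; (iii) the class of `f_β` in `GU_B(Ṽ)/F^×` is independent of
the choice of `β`, the induced map `GU(V,H) → GU_B(Ṽ)/F^×` is a group homomorphism, and its
kernel is the subgroup of `E^×`-scalar multiplications. -/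
theorem exterior_square_on_GU_mod_center
    {F E : Type*} [Field F] [CharZero F] [Field E] [Algebra F E]
    (hquad : Module.finrank F E = 2)
    (ρ : E →+* E) (hρ_invol : ∀ a, ρ (ρ a) = a) (hρ_ne : ρ ≠ RingHom.id E)
    (hρ_fixF : ∀ c : F, ρ (algebraMap F E c) = algebraMap F E c)
    (hρ_fixed_field : ∀ a : E, ρ a = a → ∃ c : F, algebraMap F E c = a)
    {V : Type*} [AddCommGroup V] [Module E V] [FiniteDimensional E V]
    (hV4 : Module.finrank E V = 4)
    (H : V → V → E)
    (H_add_left : ∀ x y z, H (x + y) z = H x z + H y z)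
    (H_add_right : ∀ x y z, H x (y + z) = H x y + H x z)
    (H_smul : ∀ (a b : E) (x y : V), H (a • x) (b • y) = ρ a * H x y * b)
    (H_conj : ∀ x y, H x y = ρ (H y x))
    (H_nondeg : ∀ x, (∀ y, H x y = 0) → x = 0)
    (d : (⋀[E]^4 V) ≃ₗ[E] E)
    (h₂ : (⋀[E]^2 V) → (⋀[E]^2 V) → E) (hh₂ : IsDetForm ρ H 2 h₂)
    (L : (⋀[E]^2 V) → (⋀[E]^2 V))
    (L_add : ∀ x y, L (x + y) = L x + L y)
    (L_smul : ∀ (a : E) (x : ⋀[E]^2 V), L (a • x) = ρ a • L x)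
    (L_def : ∀ x y : ⋀[E]^2 V, d (wedgeMul E (L x) y) = h₂ x y)
    (J : F) (hJ0 : J ≠ 0)
    (hLL : ∀ x : ⋀[E]^2 V, L (L x) = algebraMap F E J • x)
    (i0 : E) (hi0_ne : i0 ≠ 0) (hi0_trace : ρ i0 = -i0) :
    ∀ (g : V ≃ₗ[E] V) (ν : F), ν ≠ 0 →
      (∀ x y, H (g x) (g y) = algebraMap F E ν * H x y) →
      ∀ Λg : (⋀[E]^2 V) →ₗ[E] (⋀[E]^2 V),
        (∀ v : Fin 2 → V, Λg (wedgeι E 2 v) = wedgeι E 2 (⇑g ∘ v)) →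
        -- (i)
        ((algebraMap F E ν ^ 2 * (LinearMap.det (g : V →ₗ[E] V))⁻¹) *
            ρ (algebraMap F E ν ^ 2 * (LinearMap.det (g : V →ₗ[E] V))⁻¹) = 1) ∧
        -- (ii)
        (∀ β : E, β ≠ 0 →
          algebraMap F E ν ^ 2 * (LinearMap.det (g : V →ₗ[E] V))⁻¹ = β * (ρ β)⁻¹ →
          Function.Bijective (fun x : ⋀[E]^2 V => β • Λg x) ∧
          (∀ (x : ⋀[E]^2 V) (q : Qa ρ (algebraMap F E J)),
            β • Λg (actB ρ (algebraMap F E J) L x q) =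
              actB ρ (algebraMap F E J) L (β • Λg x) q) ∧
          (∀ x y : ⋀[E]^2 V,
            qform ρ (algebraMap F E J) i0 h₂ L (β • Λg x) (β • Λg y) =
              Qa.scalar ρ (algebraMap F E J) (β * ρ β * algebraMap F E ν ^ 2) *
                qform ρ (algebraMap F E J) i0 h₂ L x y) ∧
          (∃ c : F, c ≠ 0 ∧ algebraMap F E c = β * ρ β * algebraMap F E ν ^ 2)) ∧
        -- (iii): independence of the choice of β
        (∀ β β' : E, β ≠ 0 → β' ≠ 0 →
          algebraMap F E ν ^ 2 * (LinearMap.det (g : V →ₗ[E] V))⁻¹ = β * (ρ β)⁻¹ →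
          algebraMap F E ν ^ 2 * (LinearMap.det (g : V →ₗ[E] V))⁻¹ = β' * (ρ β')⁻¹ →
          ∃ t : F, t ≠ 0 ∧ β' = algebraMap F E t * β) ∧
        -- (iii): the induced map is a group homomorphism
        (∀ (g' : V ≃ₗ[E] V) (ν' : F), ν' ≠ 0 →
          (∀ x y, H (g' x) (g' y) = algebraMap F E ν' * H x y) →
          ∀ Λg' Λgg' : (⋀[E]^2 V) →ₗ[E] (⋀[E]^2 V),
            (∀ v : Fin 2 → V, Λg' (wedgeι E 2 v) = wedgeι E 2 (⇑g' ∘ v)) →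
            (∀ v : Fin 2 → V, Λgg' (wedgeι E 2 v) = wedgeι E 2 (⇑g ∘ ⇑g' ∘ v)) →
            ∀ β β' β'' : E, β ≠ 0 → β' ≠ 0 → β'' ≠ 0 →
              algebraMap F E ν ^ 2 * (LinearMap.det (g : V →ₗ[E] V))⁻¹ = β * (ρ β)⁻¹ →
              algebraMap F E ν' ^ 2 * (LinearMap.det (g' : V →ₗ[E] V))⁻¹ = β' * (ρ β')⁻¹ →
              algebraMap F E (ν * ν') ^ 2 *
                  (LinearMap.det ((g : V →ₗ[E] V) ∘ₗ (g' : V →ₗ[E] V)))⁻¹ = β'' * (ρ β'')⁻¹ →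
              ∃ t : F, t ≠ 0 ∧
                ∀ x, β'' • Λgg' x = algebraMap F E t • (β • Λg (β' • Λg' x))) ∧
        -- (iii): the kernel is the subgroup of E^×-scalar multiplications
        (∀ β : E, β ≠ 0 →
          algebraMap F E ν ^ 2 * (LinearMap.det (g : V →ₗ[E] V))⁻¹ = β * (ρ β)⁻¹ →
          ((∃ t : F, t ≠ 0 ∧ ∀ x : ⋀[E]^2 V, β • Λg x = algebraMap F E t • x) ↔
            (∃ lam : E, lam ≠ 0 ∧ ∀ u : V, g u = lam • u))) := by
  intro g ν hν hg Λg hΛ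
  set n : E := algebraMap F E ν with hn
  set D : E := LinearMap.det (g : V →ₗ[E] V) with hD
  have hn0 : n ≠ 0 := (map_ne_zero _).2 hν
  have hρn : ρ n = n := hρ_fixF ν
  have hD0 : D ≠ 0 := (LinearEquiv.isUnit_det' g).ne_zero
  have hJE : algebraMap F E J ≠ 0 := (map_ne_zero _).2 hJ0
  have hbij := Λ_bijective g Λg hΛ
  have hh := h₂_map hh₂ g n hg Λg hΛ
  have hLΛ : ∀ x, L (Λg x) = (n ^ 2 * D⁻¹) • Λg (L x) := by
    intro x
    rw [← sub_eq_zero]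
    apply wedge_nondeg hV4 d
    intro y
    obtain ⟨y, rfl⟩ := hbij.2 y
    rw [wedgeMul_sub_left, wedgeMul_smul_left, map_sub, map_smul,
      L_def, hh, d_wedgeMul_map hV4 d (g : V →ₗ[E] V) Λg hΛ, L_def, smul_eq_mul, ← hD]
    field_simp
    ring
  have hex : ∃ x : ⋀[E]^2 V, x ≠ 0 := by
    by_contra! hall
    apply volForm_ne_zero d
    ext v
    have h1 : v = ![v 0, v 1, v 2, v 3] := by ext k; fin_cases k <;> rfl
    have h2 := wedgeMul_wedgeι (E := E) ![v 0, v 1] ![v 2, v 3]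
    rw [hall (wedgeι E 2 ![v 0, v 1])] at h2
    have h3 : wedgeMul E (0 : ⋀[E]^2 V) (wedgeι E 2 ![v 2, v 3]) = 0 := by
      simpa using wedgeMul_smul_left (0 : E) 0 (wedgeι E 2 ![v 2, v 3])
    rw [h3] at h2
    rw [volForm_apply, h1]
    change d (wedgeι E 4 ![v 0, v 1, v 2, v 3]) = 0
    change 0 = wedgeι E 4 ![v 0, v 1, v 2, v 3] at h2
    rw [← h2, map_zero]
  obtain ⟨hl, hr, hs, -, -⟩ := id hh₂
  refine ⟨?_, ?_, ?_, ?_, ?_⟩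
  · obtain ⟨x, hx⟩ := hex
    have h1 := hLL (Λg x)
    rw [hLΛ, L_smul, hLΛ, hLL, map_smul, smul_smul, smul_smul] at h1
    have hx' : Λg x ≠ 0 := fun h => hx (hbij.1 (by rw [h, map_zero]))
    have h2 := smul_left_injective E hx' h1
    have h3 : (n ^ 2 * D⁻¹ * ρ (n ^ 2 * D⁻¹) - 1) * algebraMap F E J = 0 := by
      linear_combination h2
    exact sub_eq_zero.1 ((mul_eq_zero.1 h3).resolve_right hJE)
  · intro β hβ hα
    have hρβ : ρ β ≠ 0 := (map_ne_zero ρ).2 hβ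
    have hLf : ∀ x, L (β • Λg x) = β • Λg (L x) := by
      intro x
      rw [L_smul, hLΛ, hα, smul_smul]
      congr 1
      field_simp
    have hhf : ∀ x y, h₂ (β • Λg x) (β • Λg y) = β * ρ β * n ^ 2 * h₂ x y := by
      intro x y
      rw [hs, hh]; ring
    have hfix : ρ (β * ρ β * n ^ 2) = β * ρ β * n ^ 2 := by
      simp only [map_mul, map_pow, hρ_invol, hρn]; ring
    refine ⟨?_, ?_, ?_, ?_⟩
    · constructor
      · intro x y hxy
        exact hbij.1 (smul_right_injective _ hβ hxy)
      · intro y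
        obtain ⟨x, hx⟩ := hbij.2 (β⁻¹ • y)
        exact ⟨x, by simp [hx, hβ]⟩
    · intro x q
      simp only [actB, hLf, map_add, map_smul, smul_add]
      rw [smul_comm β, smul_comm β]
    · intro x y
      simp only [qform, hLf, hhf]
      generalize β * ρ β * n ^ 2 = c at hfix
      refine Prod.ext ?_ ?_
      · change i0 * (c * h₂ x y) - ((((algebraMap F E J)⁻¹ * 0 + algebraMap F E J * (0 * ρ 1)) * (i0 * (c * h₂ (L x) y))) + algebraMap F E J * (((algebraMap F E J)⁻¹ * 1 + 0 * ρ 0) * ρ 0)) =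
          c * (i0 * h₂ x y - ((((algebraMap F E J)⁻¹ * 0 + algebraMap F E J * (0 * ρ 1)) * (i0 * h₂ (L x) y)) + algebraMap F E J * (((algebraMap F E J)⁻¹ * 1 + 0 * ρ 0) * ρ 0))) + algebraMap F E J * (0 * ρ (0 - (((algebraMap F E J)⁻¹ * 0 + algebraMap F E J * (0 * ρ 1)) * 0 + ((algebraMap F E J)⁻¹ * 1 + 0 * ρ 0) * ρ (i0 * h₂ (L x) y))))
        simp
        ring
      · change 0 - (((algebraMap F E J)⁻¹ * 0 + algebraMap F E J * (0 * ρ 1)) * 0 + ((algebraMap F E J)⁻¹ * 1 + 0 * ρ 0) * ρ (i0 * (c * h₂ (L x) y))) =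
          c * (0 - (((algebraMap F E J)⁻¹ * 0 + algebraMap F E J * (0 * ρ 1)) * 0 + ((algebraMap F E J)⁻¹ * 1 + 0 * ρ 0) * ρ (i0 * h₂ (L x) y))) + 0 * ρ (i0 * h₂ x y - ((((algebraMap F E J)⁻¹ * 0 + algebraMap F E J * (0 * ρ 1)) * (i0 * h₂ (L x) y)) + algebraMap F E J * (((algebraMap F E J)⁻¹ * 1 + 0 * ρ 0) * ρ 0)))
        simp [hfix]
        ring
    · obtain ⟨c, hc⟩ := hρ_fixed_field _ hfix
      refine ⟨c, ?_, hc⟩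
      rintro rfl
      rw [map_zero] at hc
      exact mul_ne_zero (mul_ne_zero hβ hρβ) (pow_ne_zero 2 hn0) hc.symm
  · intro β β' hβ hβ' h h'
    exact ratio_fixed ρ hρ_fixed_field β β' hβ hβ' (h.symm.trans h')
  · intro g' ν' hν' hg' Λg' Λgg' hΛ' hΛ'' β β' β'' hβ hβ' hβ'' h h' h''
    obtain ⟨t, ht0, ht⟩ := ratio_fixed ρ hρ_fixed_field (β * β') β'' (mul_ne_zero hβ hβ') hβ'' (by
      rw [← h'', LinearMap.det_comp, map_mul, map_mul, mul_inv, mul_inv, mul_pow, ← hn, ← hD]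
      linear_combination (-(β' * (ρ β')⁻¹)) * h - (n ^ 2 * D⁻¹) * h')
    refine ⟨t, ht0, fun x => ?_⟩
    have hcomp : Λgg' x = Λg (Λg' x) := by
      induction x using wedge_induction with
      | h0 => simp
      | hadd x y hx hy => simp [hx, hy]
      | hsmul a x hx => simp [hx]
      | hι v => rw [hΛ'', hΛ', hΛ]
    rw [hcomp, map_smul, smul_smul, smul_smul, ht, mul_assoc]
  · intro β hβ hα
    have hρβ : ρ β ≠ 0 := (map_ne_zero ρ).2 hβ
    constructor
    · rintro ⟨t, ht0, ht⟩
      have htE : algebraMap F E t ≠ 0 := (map_ne_zero _).2 ht0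
      obtain ⟨a, ha⟩ := scalar_of_wedge_scalar hV4 d (g : V →ₗ[E] V) (β⁻¹ * algebraMap F E t)
        (mul_ne_zero (inv_ne_zero hβ) htE) (by
          intro v
          have := ht (wedgeι E 2 v)
          rw [hΛ] at this
          rw [mul_smul, ← this, smul_smul, inv_mul_cancel₀ hβ, one_smul]
          rfl)
      refine ⟨a, ?_, ha⟩
      rintro rfl
      have : Nontrivial V := Module.nontrivial_of_finrank_pos (R := E) (by omega)
      obtain ⟨u, hu⟩ := exists_ne (0 : V)
      apply hu
      apply g.injective
      have := ha u
      rw [map_zero]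
      simpa using this
    · rintro ⟨lam, hlam, hgl⟩
      have hρl : ρ lam ≠ 0 := (map_ne_zero ρ).2 hlam
      have hgl' : (g : V →ₗ[E] V) = lam • LinearMap.id := by
        ext u; simpa using hgl u
      have hDl : D = lam ^ 4 := by
        rw [hD, hgl', LinearMap.det_smul, hV4]; simp
      have hnl : n = ρ lam * lam := by
        have : Nontrivial V := Module.nontrivial_of_finrank_pos (R := E) (by omega)
        obtain ⟨u, hu⟩ := exists_ne (0 : V)
        have : ∃ y, H u y ≠ 0 := by
          by_contra! hall
          exact hu (H_nondeg u hall)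
        obtain ⟨y, hy⟩ := this
        have h1 := hg u y
        rw [hgl, hgl, H_smul] at h1
        apply mul_right_cancel₀ hy
        linear_combination -h1
      have hfix : ρ (β * lam ^ 2) = β * lam ^ 2 := by
        rw [hDl, hnl] at hα
        rw [map_mul, map_pow]
        field_simp at hα
        linear_combination hα
      obtain ⟨t, ht⟩ := hρ_fixed_field _ hfix
      refine ⟨t, ?_, fun x => ?_⟩
      · rintro rfl
        rw [map_zero] at ht
        exact mul_ne_zero hβ (pow_ne_zero 2 hlam) ht.symm
      · rw [ht, mul_smul]
        congr 1
        induction x using wedge_induction with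
        | h0 => simp
        | hadd x y hx hy => simp [hx, hy]
        | hsmul a x hx => rw [map_smul, hx, smul_comm]
        | hι v =>
          rw [hΛ]
          have : ⇑g ∘ v = fun i => lam • v i := by ext i; exact hgl _
          rw [this, wedgeι_eq, wedgeι_eq,
            AlternatingMap.map_smul_univ (exteriorPower.ιMulti E 2) (fun _ => lam) v]
          simp
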